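/- arXiv:1109.3596 — 2 statements merged into one kernel-verified Lean document; each statement's English description precedes it below -/
import Mathlib

section
/- Let n be an odd composite Carmichael number (so a^(n-1) ≡ 1 (mod n) for all units a of Z/nZ) that is not a special Carmichael number, i.e. there exists a unit b of Z/nZ with b^((n-1)/2) ≢ 1 (mod n). Then there exists an integer x coprime to n with x^((n-1)/2) ≢ 1 (mod n) and Jacobi symbol (x/n) = 1. -/
/-- If the unit group of `ZMod n` has exponent dividing `n - 1`, then `n` is squarefree. -/
theorem squarefree_of_forall_units_pow_eq_one {n : ℕ} (hn : 0 < n)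
    (h : ∀ a : (ZMod n)ˣ, (a : ZMod n) ^ (n - 1) = 1) : Squarefree n := by
  rw [Nat.squarefree_iff_prime_squarefree]
  rintro p hp ⟨k, rfl⟩
  have hk : 0 < k := Nat.pos_of_mul_pos_left hn
  set n := p * p * k with hndef
  set t : ZMod n := ((p * k : ℕ) : ZMod n) with htdef
  have ht : t * t = 0 := by
    rw [htdef, ← Nat.cast_mul, ZMod.natCast_eq_zero_iff]
    exact ⟨k, by rw [hndef]; ring⟩
  have hpow : ∀ m : ℕ, (1 + t) ^ m = 1 + m * t := by
    intro m
    induction m with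
    | zero => simp
    | succ m ih =>
      rw [pow_succ, ih]
      push_cast
      linear_combination (m : ZMod n) * ht
  have hunit : IsUnit (1 + t) :=
    IsUnit.of_mul_eq_one (1 - t) (by linear_combination -ht)
  have h1 : (1 + t) ^ (n - 1) = 1 := h hunit.unit
  have h2 : (1 + t) ^ (n - 1 + 1) = 1 := by
    rw [Nat.sub_add_cancel hn, hpow]
    simp
  rw [pow_succ, h1, one_mul, add_eq_left, htdef, ZMod.natCast_eq_zero_iff] at h2
  have hle := Nat.le_of_dvd (Nat.mul_pos hp.pos hk) h2
  have := Nat.mul_pos hp.pos hk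
  rw [hndef] at hle
  nlinarith [hp.two_le]

/-- A squarefree number divides an integer as soon as all its prime factors do. -/
theorem Squarefree.natCast_dvd_int_of_forall_prime {n : ℕ} (hn : Squarefree n) {z : ℤ}
    (h : ∀ p : ℕ, p.Prime → p ∣ n → (p : ℤ) ∣ z) : (n : ℤ) ∣ z := by
  rw [Int.natCast_dvd, ← Nat.prod_primeFactors_of_squarefree hn]
  refine Finset.prod_primes_dvd _ (fun p hp => (Nat.prime_of_mem_primeFactors hp).prime)
    fun p hp => ?_
  exact Int.natCast_dvd.mp
    (h p (Nat.prime_of_mem_primeFactors hp) (Nat.dvd_of_mem_primeFactors hp))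

/-- For an odd prime `q` coprime to `m ≠ 0`, some integer that is `1` modulo `m`
has Jacobi symbol `-1` modulo `q * m`. -/
theorem exists_modEq_one_jacobiSym_eq_neg_one {q m : ℕ} (hq : q.Prime) (hq2 : q ≠ 2) (hm : m ≠ 0)
    (hqm : q.Coprime m) : ∃ z : ℤ, z ≡ 1 [ZMOD m] ∧ jacobiSym z (q * m) = -1 := by
  have : Fact q.Prime := ⟨hq⟩
  have : NeZero m := ⟨hm⟩
  obtain ⟨g, hg⟩ := quadraticChar_exists_neg_one (F := ZMod q) (by rwa [ZMod.ringChar_zmod_n])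
  obtain ⟨z, hzq, hzm⟩ := Nat.chineseRemainder hqm g.val 1
  have hzm' : (z : ℤ) ≡ 1 [ZMOD m] := by exact_mod_cast Int.natCast_modEq_iff.mpr hzm
  refine ⟨z, hzm', ?_⟩
  have h1 : jacobiSym z m = 1 := by
    rw [jacobiSym.mod_left, hzm', ← jacobiSym.mod_left, jacobiSym.one_left]
  have h2 : jacobiSym z q = -1 := by
    have hz : ((z : ℤ) : ZMod q) = g := by
      rw [Int.cast_natCast, (ZMod.natCast_eq_natCast_iff _ _ _).mpr hzq, ZMod.natCast_zmod_val]
    rw [← jacobiSym.legendreSym.to_jacobiSym, legendreSym, hz, hg]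
  rw [jacobiSym.mul_right, h1, h2, mul_one]

/-- Let `n` be an odd composite Carmichael number that is not a special
Carmichael number (i.e. some unit `b` has `b ^ ((n-1)/2) ≢ 1 (mod n)`). Then
there is an integer `x` coprime to `n` with `x ^ ((n-1)/2) ≢ 1 (mod n)` and
Jacobi symbol `(x/n) = 1`. -/
theorem stmt_10 (n : ℕ) (hn : 1 < n) (hodd : Odd n) (hcomp : ¬ n.Prime)
    (hcarmichael : ∀ a : (ZMod n)ˣ, (a : ZMod n) ^ (n - 1) = 1)
    (hb : ∃ b : (ZMod n)ˣ, (b : ZMod n) ^ ((n - 1) / 2) ≠ 1) :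
    ∃ x : ℤ, Int.gcd x n = 1 ∧ (x : ZMod n) ^ ((n - 1) / 2) ≠ 1 ∧ jacobiSym x n = 1 := by
  have hn0 : n ≠ 0 := by lia
  have : NeZero n := ⟨hn0⟩
  have hsq := squarefree_of_forall_units_pow_eq_one (by lia) hcarmichael
  obtain ⟨b, hb⟩ := hb
  set e := (n - 1) / 2
  set B : ℤ := ((b : ZMod n).val : ℤ) with hB
  have hBb : (B : ZMod n) = b := by simp [hB]
  have hBn : Int.gcd B n = 1 := by
    rw [hB, Int.gcd_natCast_natCast]
    exact ZMod.val_coe_unit_coprime b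
  have hpow_iff (m : ℕ) (x : ℤ) : (x : ZMod m) ^ e = 1 ↔ (m : ℤ) ∣ x ^ e - 1 := by
    rw [← ZMod.intCast_zmod_eq_zero_iff_dvd, ← sub_eq_zero]
    push_cast
    rfl
  obtain ⟨p, hp, hpn, hpB⟩ : ∃ p : ℕ, p.Prime ∧ p ∣ n ∧ ¬ (p : ℤ) ∣ B ^ e - 1 := by
    by_contra! hall
    rw [← hBb] at hb
    exact hb ((hpow_iff n B).mpr (hsq.natCast_dvd_int_of_forall_prime hall))
  rcases jacobiSym.eq_one_or_neg_one hBn with hJ | hJ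
  · exact ⟨B, hBn, by rwa [hBb], hJ⟩
  obtain ⟨k, hk⟩ := hpn
  have hk1 : k ≠ 1 := by
    rintro rfl
    exact hcomp (by rwa [hk, mul_one])
  obtain ⟨q, hq, l, rfl⟩ := Nat.exists_prime_and_dvd hk1
  have hnq : n = q * (p * l) := by rw [hk]; ring
  obtain ⟨z, hz, hzJ⟩ := exists_modEq_one_jacobiSym_eq_neg_one hq
    (by rintro rfl; exact Nat.not_even_iff_odd.mpr hodd ⟨p * l, by rw [hnq]; ring⟩)
    (by rintro h; simp [hnq, h] at hn0) (Nat.coprime_of_squarefree_mul (hnq ▸ hsq))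
  rw [← hnq] at hzJ
  have hJ1 : jacobiSym (B * z) n = 1 := by rw [jacobiSym.mul_left, hJ, hzJ]; norm_num
  refine ⟨B * z, ?_, ?_, hJ1⟩
  · by_contra hne
    rw [jacobiSym.eq_zero_iff_not_coprime.mpr hne] at hJ1
    norm_num at hJ1
  · intro h
    rw [hpow_iff] at h
    have hzp : z ≡ 1 [ZMOD p] := hz.of_dvd (by exact_mod_cast Nat.dvd_mul_right p l)
    have hmod : (B * z) ^ e ≡ B ^ e [ZMOD p] := by simpa using (hzp.mul_left B).pow e
    have hpn : (p : ℤ) ∣ (B * z) ^ e - 1 := dvd_trans (Int.natCast_dvd_natCast.mpr ⟨_, hk⟩) h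
    have := dvd_sub hpn hmod.symm.dvd
    exact hpB (by simpa using this)
end

section
/- Let n be an odd composite natural number. If the number of Euler liars for n, i.e. units a of Z/nZ with a^((n-1)/2) ≡ (a/n) (mod n), equals φ(n)/2, then n is a Carmichael number, i.e. a^(n-1) ≡ 1 (mod n) for every unit a of Z/nZ. -/
theorem jacobiSym_val_mul (n : ℕ) (a b : ZMod n) :
    jacobiSym ((a * b).val : ℤ) n = jacobiSym (a.val : ℤ) n * jacobiSym (b.val : ℤ) n := by
  rw [ZMod.val_mul, Int.natCast_mod, ← jacobiSym.mod_left, Nat.cast_mul, jacobiSym.mul_left]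

theorem jacobiSym_val_one {n : ℕ} (hn : 1 < n) :
    jacobiSym ((1 : ZMod n).val : ℤ) n = 1 := by
  rw [ZMod.val_one'' hn.ne', Nat.cast_one, jacobiSym.one_left]

/-- The subgroup of Euler liars for `n`. -/
def eulerLiars (n : ℕ) (hn : 1 < n) : Subgroup (ZMod n)ˣ where
  carrier := {a | (a : ZMod n) ^ ((n - 1) / 2) =
    ((jacobiSym ((a : ZMod n).val : ℤ) n : ℤ) : ZMod n)}
  one_mem' := by
    simp only [Set.mem_ofPred_eq, Units.val_one, one_pow, jacobiSym_val_one hn, Int.cast_one]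
  mul_mem' := by
    intro a b ha hb
    simp only [Set.mem_ofPred_eq] at ha hb ⊢
    rw [Units.val_mul, mul_pow, ha, hb, jacobiSym_val_mul, Int.cast_mul]
  inv_mem' := by
    intro a ha
    simp only [Set.mem_ofPred_eq] at ha ⊢
    refine (a.isUnit.pow ((n - 1) / 2)).mul_left_cancel ?_
    rw [← mul_pow, Units.mul_inv, one_pow, ha, ← Int.cast_mul, ← jacobiSym_val_mul,
      Units.mul_inv, jacobiSym_val_one hn, Int.cast_one]

/-- If the number of Euler liars for an odd composite `n` equals `φ(n)/2`,
then `n` is a Carmichael number. -/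
theorem stmt_13 (n : ℕ) (hn : 1 < n) (hodd : Odd n) (hcomp : ¬ n.Prime)
    (hliars : Nat.card {a : (ZMod n)ˣ //
        (a : ZMod n) ^ ((n - 1) / 2) = ((jacobiSym ((a : ZMod n).val : ℤ) n : ℤ) : ZMod n)}
      = n.totient / 2) :
    ∀ a : (ZMod n)ˣ, (a : ZMod n) ^ (n - 1) = 1 := by
  intro a
  obtain ⟨k, hk⟩ := hodd
  have : NeZero n := ⟨by omega⟩
  have hcard : Nat.card (eulerLiars n hn) = n.totient / 2 := hliars
  have hG : Nat.card (ZMod n)ˣ = n.totient := by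
    rw [Nat.card_eq_fintype_card, ZMod.card_units_eq_totient]
  have heven : n.totient / 2 * 2 = n.totient :=
    Nat.div_mul_cancel (Nat.totient_even (by omega)).two_dvd
  have hpos : 0 < n.totient := Nat.totient_pos.2 (by omega)
  have hindex : (eulerLiars n hn).index = 2 := by
    have h := (eulerLiars n hn).card_mul_index
    rw [hcard, hG] at h
    exact Nat.eq_of_mul_eq_mul_left (by omega) (h.trans heven.symm)
  have hsq : ((a ^ 2 : (ZMod n)ˣ) : ZMod n) ^ ((n - 1) / 2) =
      ((jacobiSym (((a ^ 2 : (ZMod n)ˣ) : ZMod n).val : ℤ) n : ℤ) : ZMod n) :=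
    Subgroup.sq_mem_of_index_two hindex a
  have hcop : Int.gcd ((a : ZMod n).val : ℤ) n = 1 := by
    rw [Int.gcd_natCast_natCast]
    exact ZMod.val_coe_unit_coprime a
  rw [Units.val_pow_eq_pow_val, ← pow_mul, sq, jacobiSym_val_mul, ← sq,
    jacobiSym.sq_one hcop, Int.cast_one] at hsq
  rwa [show 2 * ((n - 1) / 2) = n - 1 by omega] at hsq
end
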